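/- Let E be a finite homogeneous effect algebra such that S(E) = {0, 1}, and let a be an atom of E. Suppose n ≥ 1 and n·a is well defined. If n·a ≤ a', then [0, n·a] = {0, a, 2·a, …, n·a}. -/

import Mathlib

namespace EffectAlgebraPaper

/-- An effect algebra: a set with 0, 1 and a partially defined sum `add`,
whose domain is the relation `Orth` (written `a ⊥ b` in the paper). -/
class EffectAlgebra (E : Type*) where
  zero : E
  one : E
  /-- `Orth a b` means `a ⊕ b` is defined. -/
  Orth : E → E → Prop
  /-- The sum `a ⊕ b`, meaningful only when `Orth a b`. -/
  add : E → E → E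
  orth_comm : ∀ a b : E, Orth a b → Orth b a
  add_comm : ∀ a b : E, Orth a b → add a b = add b a
  assoc : ∀ a b c : E, Orth b c → Orth a (add b c) →
    Orth a b ∧ Orth (add a b) c ∧ add a (add b c) = add (add a b) c
  compl_exists : ∀ a : E, ∃! b : E, Orth a b ∧ add a b = one
  orth_one : ∀ a : E, Orth a one → a = zero

namespace EffectAlgebra

variable {E : Type*} [EffectAlgebra E]

/-- The orthosupplement `a'`. -/
noncomputable def compl (a : E) : E := (compl_exists a).exists.choose

/-- The effect-algebra partial order: `a ≤ b` iff `a ⊕ c = b` for some `c`. -/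
def le (a b : E) : Prop := ∃ c : E, Orth a c ∧ add a c = b

/-- The interval `[x, y] = {z : x ≤ z ≤ y}`. -/
def Interval (x y : E) : Set E := { z : E | le x z ∧ le z y }

/-- An atom: a minimal nonzero element. -/
def Atom (a : E) : Prop := a ≠ zero ∧ ∀ b : E, b ≠ zero → le b a → b = a

/-- A sharp element: the only common lower bound of `x` and `x'` is `0`. -/
def Sharp (x : E) : Prop := ∀ b : E, le b x → le b (compl x) → b = zero

/-- `S(E)`, the set of sharp elements. -/
def sharpSet (E : Type*) [EffectAlgebra E] : Set E := { x : E | Sharp x }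

/-- Homogeneity: `u ≤ v₁ ⊕ v₂ ≤ u'` implies `u = u₁ ⊕ u₂` with `u₁ ≤ v₁`, `u₂ ≤ v₂`. -/
def Homogeneous (E : Type*) [EffectAlgebra E] : Prop :=
  ∀ u v₁ v₂ : E, Orth v₁ v₂ → le u (add v₁ v₂) → le (add v₁ v₂) (compl u) →
    ∃ u₁ u₂ : E, le u₁ v₁ ∧ le u₂ v₂ ∧ Orth u₁ u₂ ∧ add u₁ u₂ = u

/-- `nmul n a` is the iterated sum `n·a = a ⊕ ⋯ ⊕ a` (`n` times), with `0·a = 0`;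
it is meaningful only when `nmulDef n a` holds. -/
def nmul : ℕ → E → E
  | 0, _ => zero
  | n + 1, a => add (nmul n a) a

/-- `nmulDef n a` says the iterated sum `n·a` is well defined. -/
def nmulDef : ℕ → E → Prop
  | 0, _ => True
  | n + 1, a => nmulDef n a ∧ Orth (nmul n a) a

end EffectAlgebra

namespace EffectAlgebra

variable {E : Type*} [EffectAlgebra E]

theorem compl_spec (a : E) : Orth a (compl a) ∧ add a (compl a) = one :=
  (compl_exists a).exists.choose_spec

theorem eq_compl {a b : E} (h : Orth a b) (hab : add a b = one) : b = compl a :=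
  (compl_exists a).unique ⟨h, hab⟩ (compl_spec a)

theorem assoc_right {a b c : E} (hab : Orth a b) (habc : Orth (add a b) c) :
    Orth b c ∧ Orth a (add b c) ∧ add (add a b) c = add a (add b c) := by
  have hc := orth_comm _ _ habc
  rw [add_comm _ _ hab] at hc
  obtain ⟨h₁, h₂, h₃⟩ := assoc c b a (orth_comm _ _ hab) hc
  rw [add_comm _ _ h₁] at h₂ h₃
  refine ⟨orth_comm _ _ h₁, orth_comm _ _ h₂, ?_⟩
  rw [add_comm _ _ habc, add_comm _ _ hab, h₃, add_comm _ _ h₂]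

theorem compl_one : compl (one : E) = zero :=
  orth_one _ (orth_comm _ _ (compl_spec one).1)

theorem compl_compl (a : E) : compl (compl a) = a := by
  obtain ⟨h, h'⟩ := compl_spec a
  exact (eq_compl (orth_comm _ _ h) (by rw [← add_comm _ _ h, h'])).symm

theorem zero_add (a : E) : Orth zero a ∧ add zero a = a := by
  obtain ⟨h₁, h₁'⟩ := compl_spec (one : E)
  rw [compl_one] at h₁ h₁'
  have h₀ := orth_comm _ _ h₁
  have h₀' := h₁'
  rw [add_comm _ _ h₁] at h₀'
  obtain ⟨ha, ha'⟩ := compl_spec a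
  have hc := orth_comm _ _ ha
  have hc' := ha'
  rw [add_comm _ _ ha] at hc'
  obtain ⟨h₂, h₃, h₄⟩ := assoc zero a (compl a) ha (by rwa [ha'])
  refine ⟨h₂, ?_⟩
  have h₅ : add (compl a) (add zero a) = one := by
    rw [← add_comm _ _ h₃, ← h₄, ha', h₀']
  rw [eq_compl (orth_comm _ _ h₃) h₅, compl_compl]

theorem zero_le (a : E) : le zero a := ⟨a, zero_add a⟩

theorem add_left_cancel {a b c : E} (hb : Orth a b) (hc : Orth a c)
    (h : add a b = add a c) : b = c := by
  obtain ⟨hd, hd'⟩ := compl_spec (add a b)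
  rw [add_comm _ _ hd] at hd'
  have hd := orth_comm _ _ hd
  obtain ⟨-, h₁, h₂⟩ := assoc _ a b hb hd
  obtain ⟨-, h₃, h₄⟩ := assoc (compl (add a b)) a c hc (by rwa [← h])
  rw [eq_compl h₁ (h₂.symm.trans hd'), eq_compl h₃ (by rw [← h₄, ← h, hd'])]

theorem eq_zero_of_add_eq_zero {a b : E} (h : Orth a b) (hab : add a b = zero) : a = zero :=
  orth_one _ (orth_comm _ _ (assoc one a b h
    (by rw [hab]; exact orth_comm _ _ (zero_add one).1)).1)

theorem orth_of_le_compl {a b : E} (h : le a (compl b)) : Orth a b := by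
  obtain ⟨c, hc, hc'⟩ := h
  exact orth_comm _ _ (assoc b a c hc (by rw [hc']; exact (compl_spec b).1)).1

theorem le_compl_of_orth {a b : E} (h : Orth a b) : le a (compl b) := by
  have h' := orth_comm _ _ h
  obtain ⟨hc, hc'⟩ := compl_spec (add b a)
  obtain ⟨h₁, h₂, h₃⟩ := assoc_right h' hc
  exact ⟨_, h₁, eq_compl h₂ (h₃.symm.trans hc')⟩

theorem le_trans {a b c : E} (hab : le a b) (hbc : le b c) : le a c := by
  obtain ⟨x, hx, rfl⟩ := hab
  obtain ⟨y, hy, rfl⟩ := hbc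
  obtain ⟨-, h₁, h₂⟩ := assoc_right hx hy
  exact ⟨_, h₁, h₂.symm⟩

theorem Atom.eq_zero_or_eq {a b : E} (ha : Atom a) (hb : le b a) : b = zero ∨ b = a :=
  or_iff_not_imp_left.2 fun h => ha.2 b h hb

theorem nmul_le_nmul {a : E} {m n : ℕ} (hmn : m ≤ n) (hdef : nmulDef n a) :
    le (nmul m a) (nmul n a) := by
  induction n, hmn using Nat.le_induction with
  | base => exact ⟨zero, orth_comm _ _ (zero_add _).1, by
      rw [← add_comm _ _ (zero_add _).1, (zero_add _).2]⟩
  | succ n _ ih => exact le_trans (ih hdef.1) ⟨a, hdef.2, rfl⟩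

/-- If an atom `a` is orthogonal to a sum above it, homogeneity places it below a summand. -/
theorem Atom.le_or_le_of_le_add (hhom : Homogeneous E) {a x y : E} (ha : Atom a)
    (hxy : Orth x y) (hle : le a (add x y)) (horth : Orth (add x y) a) : le a x ∨ le a y := by
  obtain ⟨u, v, hu, hv, huv, h⟩ := hhom a x y hxy hle (le_compl_of_orth horth)
  rcases ha.eq_zero_or_eq (b := u) ⟨v, huv, h⟩ with rfl | rfl
  · rw [(zero_add v).2] at h
    exact .inr (h ▸ hv)
  · exact .inl hu

theorem Atom.eq_nmul_of_add_eq_nmul (hhom : Homogeneous E) {a : E} (ha : Atom a) {n : ℕ}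
    (hdef : nmulDef (n + 1) a) {x y : E} (hxy : Orth x y) (h : add x y = nmul n a) :
    ∃ m ≤ n, x = nmul m a := by
  induction n generalizing x y with
  | zero => exact ⟨0, le_rfl, eq_zero_of_add_eq_zero hxy h⟩
  | succ n ih =>
    have hn : Orth (nmul n a) a := hdef.1.2
    have ha_le : le a (add x y) :=
      ⟨nmul n a, orth_comm _ _ hn, by rw [h, ← add_comm _ _ hn]; rfl⟩
    have horth : Orth (add x y) a := by rw [h]; exact hdef.2
    have hadd : nmul (n + 1) a = add a (nmul n a) := add_comm _ _ hn
    rcases ha.le_or_le_of_le_add hhom hxy ha_le horth with ⟨z, hz, rfl⟩ | ⟨z, hz, rfl⟩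
    · obtain ⟨h₁, h₂, h₃⟩ := assoc_right hz hxy
      obtain ⟨m, hm, rfl⟩ := ih hdef.1 h₁
        (add_left_cancel h₂ (orth_comm _ _ hn) (by rw [← h₃, h, hadd]))
      exact ⟨m + 1, by omega, add_comm _ _ hz⟩
    · obtain ⟨h₁, h₂, h₃⟩ := assoc x a z hz hxy
      rw [add_comm _ _ h₁] at h₂ h₃
      obtain ⟨h₄, h₅, h₆⟩ := assoc_right (orth_comm _ _ h₁) h₂
      obtain ⟨m, hm, hx⟩ := ih hdef.1 h₄
        (add_left_cancel h₅ (orth_comm _ _ hn) (by rw [← h₆, ← h₃, h, hadd]))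
      exact ⟨m, by omega, hx⟩

end EffectAlgebra

open EffectAlgebra

/-- Theorem (thm36): in a finite homogeneous effect algebra with `S(E) = {0, 1}`,
if `a` is an atom, `n ≥ 1`, `n·a` is well defined and `n·a ≤ a'`,
then `[0, n·a] = {0, a, 2·a, …, n·a}`. -/
theorem stmt8 {E : Type*} [EffectAlgebra E] [Finite E] (hhom : Homogeneous E)
    (hS : sharpSet E = {zero, one})
    (a : E) (ha : Atom a) (n : ℕ) (hn : 1 ≤ n) (hdef : nmulDef n a)
    (hle : le (nmul n a) (compl a)) :
    Interval zero (nmul n a) = { x : E | ∃ m ≤ n, x = nmul m a } := by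
  ext x
  constructor
  · rintro ⟨-, y, hxy, h⟩
    exact ha.eq_nmul_of_add_eq_nmul hhom ⟨hdef, orth_of_le_compl hle⟩ hxy h
  · rintro ⟨m, hm, rfl⟩
    exact ⟨zero_le _, nmul_le_nmul hm hdef⟩

end EffectAlgebraPaper
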